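/- arXiv:0812.3186 — 2 statements merged into one kernel-verified Lean document; each statement's English description precedes it below -/
import Mathlib

section
/- Let k, m ≥ 2 be integers and ε > 0. Then there exist an infinite word x over an alphabet of size k and an integer d_0 = d_0(ε) such that for all d > d_0, taking r = (0, d, 2d, …, (m−1)d), we have D_r^d ≥ 1 − 1/k^{m−1} − ε. -/
open Filter Finset

namespace LocCorr

open Classical in
/-- number of monochromatic positions -/
noncomputable def cnt {k : ℕ} (m : ℕ) (x : ℕ → Fin k) (n d : ℕ) : ℕ :=
  ((range d).filter (fun i => ∀ i' j' : Fin m, x (n + i + i'.1 * d) = x (n + i + j'.1 * d))).card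

/-- the window at `n` with difference `d` is bad -/
def Bad {k : ℕ} (m : ℕ) (a : ℝ) (x : ℕ → Fin k) (n d : ℕ) : Prop := a * d < cnt m x n d

/-- no bad window within the first `N` letters -/
def Good {k : ℕ} (m : ℕ) (a : ℝ) (d₀ N : ℕ) (x : ℕ → Fin k) : Prop :=
  ∀ d n : ℕ, d₀ < d → n + m * d ≤ N → ¬ Bad m a x n d

/-- extension by zero -/
def ext {k : ℕ} [NeZero k] {N : ℕ} (w : Fin N → Fin k) : ℕ → Fin k :=
  fun n => if h : n < N then w ⟨n, h⟩ else 0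

open Classical in
/-- number of good words of length `N` -/
noncomputable def c (k : ℕ) [NeZero k] (m : ℕ) (a : ℝ) (d₀ N : ℕ) : ℕ :=
  (univ.filter (fun w : Fin N → Fin k => Good m a d₀ N (ext w))).card

open Classical in
/-- number of bad words for `d` -/
noncomputable def B (k : ℕ) [NeZero k] (m : ℕ) (a : ℝ) (d : ℕ) : ℕ :=
  (univ.filter (fun w : Fin (m * d) → Fin k => Bad m a (ext w) 0 d)).card

lemma pos_lt {m n d N i : ℕ} (h : n + m * d ≤ N) (hi : i < d) (i' : Fin m) :
    n + i + i'.1 * d < N := by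
  have : (i'.1 + 1) * d ≤ m * d := Nat.mul_le_mul_right _ i'.2
  rw [add_mul] at this
  omega

lemma cnt_congr {k m : ℕ} {x y : ℕ → Fin k} {n n' d : ℕ}
    (h : ∀ j < m * d, x (n + j) = y (n' + j)) : cnt m x n d = cnt m y n' d := by
  unfold cnt
  congr 1
  apply filter_congr
  intro i hi
  have hi := mem_range.1 hi
  have key : ∀ i' : Fin m, x (n + i + i'.1 * d) = y (n' + i + i'.1 * d) := by
    intro i'
    have := pos_lt (n := 0) (N := m * d) (by omega) hi i'
    rw [add_assoc, add_assoc]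
    exact h _ (by omega)
  simp only [key]

lemma good_congr {k m : ℕ} {a : ℝ} {d₀ N : ℕ} {x y : ℕ → Fin k}
    (h : ∀ j < N, x j = y j) : Good m a d₀ N x ↔ Good m a d₀ N y := by
  unfold Good Bad
  refine forall_congr' fun d => forall_congr' fun n => imp_congr_right fun hd => imp_congr_right
    fun hn => ?_
  rw [cnt_congr (x := x) (y := y) (n := n) (n' := n)]
  intro j hj
  exact h _ (by omega)

lemma good_mono {k m : ℕ} {a : ℝ} {d₀ N M : ℕ} (hNM : N ≤ M) {x : ℕ → Fin k}
    (h : Good m a d₀ M x) : Good m a d₀ N x := fun d n hd hn => h d n hd (hn.trans hNM)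

open Classical in
/-- words of length `L` with good initial part of length `a'` and bad factor after -/
lemma card_split (k : ℕ) [NeZero k] (m : ℕ) (a : ℝ) (d₀ a' d L : ℕ) (hL : L = a' + m * d) :
    (univ.filter (fun w : Fin L → Fin k => Good m a d₀ a' (ext w) ∧ Bad m a (ext w) a' d)).card
      ≤ c k m a d₀ a' * B k m a d := by
  subst hL
  unfold c B
  rw [← card_product]
  refine card_le_card_of_injOn
    (fun w => (fun i => w (Fin.castAdd _ i), fun i => w (Fin.natAdd _ i))) ?_ ?_
  · intro w hw
    simp only [coe_filter, mem_univ, true_and, Set.mem_ofPred_eq] at hw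
    simp only [coe_product, coe_filter, mem_univ, true_and, Set.mem_prod, Set.mem_ofPred_eq]
    refine ⟨(good_congr ?_).1 hw.1, ?_⟩
    · intro j hj
      simp [ext, hj, show j < a' + m * d by omega, Fin.castAdd, Fin.castLE]
    · have := hw.2
      unfold Bad at this ⊢
      rwa [cnt_congr (n' := 0) (y := ext (fun i => w (Fin.natAdd _ i)))] at this
      intro j hj
      simp [ext, hj, Fin.natAdd]
  · intro w _ w' _ h
    simp only [Prod.mk.injEq] at h
    funext i
    refine Fin.addCases (fun i => ?_) (fun i => ?_) i
    · exact congrFun h.1 i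
    · exact congrFun h.2 i

open Classical in
lemma card_initial (k : ℕ) [NeZero k] (m : ℕ) (a : ℝ) (d₀ N : ℕ) :
    k * c k m a d₀ N ≤
    (univ.filter (fun w : Fin (N + 1) → Fin k => Good m a d₀ N (ext w))).card := by
  unfold c
  have : ∀ t : ℕ, k * t = (univ : Finset (Fin k)).card * t := by simp
  rw [this, ← card_product]
  refine card_le_card_of_injOn (fun p => Fin.snoc (α := fun _ => Fin k) p.2 p.1) ?_ ?_
  · rintro ⟨z, w⟩ hw
    simp only [coe_product, coe_filter, mem_univ, true_and, Set.mem_prod, Set.mem_ofPred_eq,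
      coe_univ, Set.mem_univ] at hw
    simp only [coe_filter, mem_univ, true_and, Set.mem_ofPred_eq]
    refine (good_congr ?_).1 hw
    intro j hj
    simp [ext, hj, show j < N + 1 by omega, Fin.snoc]
  · rintro ⟨z, w⟩ _ ⟨z', w'⟩ _ h
    have h1 := congrArg (Fin.init (α := fun _ => Fin k)) h
    have h2 := congrFun h (Fin.last N)
    simp at h1 h2
    simp [h1, h2]

open Classical in
lemma count_step (k : ℕ) [NeZero k] (m : ℕ) (hm : 1 ≤ m) (a : ℝ) (d₀ N : ℕ) :
    k * c k m a d₀ N ≤ c k m a d₀ (N + 1) +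
      ∑ d ∈ (Ioc d₀ (N + 1)).filter (fun d => m * d ≤ N + 1),
        c k m a d₀ (N + 1 - m * d) * B k m a d := by
  refine (card_initial k m a d₀ N).trans ?_
  have hsub : (univ.filter (fun w : Fin (N + 1) → Fin k => Good m a d₀ N (ext w))) ⊆
      (univ.filter (fun w : Fin (N + 1) → Fin k => Good m a d₀ (N + 1) (ext w))) ∪
      ((Ioc d₀ (N + 1)).filter (fun d => m * d ≤ N + 1)).biUnion (fun d =>
        univ.filter (fun w : Fin (N + 1) → Fin k =>
          Good m a d₀ (N + 1 - m * d) (ext w) ∧ Bad m a (ext w) (N + 1 - m * d) d)) := by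
    intro w hw
    simp only [mem_filter, mem_univ, true_and, mem_union, mem_biUnion, mem_Ioc] at hw ⊢
    by_cases hg : Good m a d₀ (N + 1) (ext w)
    · exact Or.inl hg
    · right
      unfold Good at hg
      push Not at hg
      obtain ⟨d, n, hd, hn, hb⟩ := hg
      have hnN : n + m * d = N + 1 := by
        by_contra hne
        exact hw d n hd (by omega) hb
      have hdm : d ≤ m * d := Nat.le_mul_of_pos_left d hm
      have hn' : N + 1 - m * d = n := by omega
      refine ⟨d, ⟨⟨hd, by omega⟩, by omega⟩, ?_, ?_⟩
      · exact good_mono (by omega) hw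
      · rw [hn']; exact hb
  refine (card_le_card hsub).trans ((card_union_le _ _).trans ?_)
  refine Nat.add_le_add le_rfl (card_biUnion_le.trans (sum_le_sum ?_))
  intro d hd
  simp only [mem_filter] at hd
  exact card_split k m a d₀ _ d _ (by omega)

lemma growth (k : ℕ) [NeZero k] (m : ℕ) (hm : 1 ≤ m) (a : ℝ) (d₀ : ℕ) (θ q : ℝ) (hθ : 0 < θ)
    (hB : ∀ d, (B k m a d : ℝ) ≤ (k * θ) ^ (m * d) * q ^ d)
    (hq : ∀ N, θ * (1 + ∑ d ∈ Ioc d₀ N, q ^ d) ≤ 1) (hq0 : 0 ≤ q) (N : ℕ) :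
    k * θ * c k m a d₀ N ≤ c k m a d₀ (N + 1) := by
  have hk : (0 : ℝ) < k := by exact_mod_cast Nat.pos_of_ne_zero (NeZero.ne k)
  set β : ℝ := k * θ with hβ
  have hβ0 : 0 < β := by positivity
  induction N using Nat.strong_induction_on with
  | _ N ih =>
  have hpow : ∀ j N', N' + j = N → β ^ j * c k m a d₀ N' ≤ c k m a d₀ N := by
    intro j
    induction j with
    | zero => intro N' h; simp at h; subst h; simp
    | succ j ihj =>
      intro N' h
      have h1 := ih N' (by omega)
      have h2 := ihj (N' + 1) (by omega)
      calc β ^ (j + 1) * c k m a d₀ N' = β ^ j * (β * c k m a d₀ N') := by ring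
        _ ≤ β ^ j * c k m a d₀ (N' + 1) := by gcongr
        _ ≤ _ := h2
  have hstep : (k : ℝ) * c k m a d₀ N ≤ c k m a d₀ (N + 1) +
      ∑ d ∈ (Ioc d₀ (N + 1)).filter (fun d => m * d ≤ N + 1),
        (c k m a d₀ (N + 1 - m * d) : ℝ) * B k m a d := by
    exact_mod_cast count_step k m hm a d₀ N
  have hsum : ∑ d ∈ (Ioc d₀ (N + 1)).filter (fun d => m * d ≤ N + 1),
        (c k m a d₀ (N + 1 - m * d) : ℝ) * B k m a d ≤
      ∑ d ∈ Ioc d₀ (N + 1), β * c k m a d₀ N * q ^ d := by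
    refine (sum_le_sum ?_).trans (sum_le_sum_of_subset_of_nonneg (filter_subset _ _) ?_)
    · intro d hd
      simp only [mem_filter, mem_Ioc] at hd
      have hmd : 1 ≤ m * d := Nat.mul_pos hm (by omega)
      obtain ⟨j, hj⟩ : ∃ j, m * d = j + 1 := ⟨m * d - 1, by omega⟩
      have h1 := hpow j (N + 1 - m * d) (by omega)
      calc (c k m a d₀ (N + 1 - m * d) : ℝ) * B k m a d
          ≤ c k m a d₀ (N + 1 - m * d) * (β ^ (m * d) * q ^ d) := by
            gcongr; exact hB d
        _ = β * (β ^ j * c k m a d₀ (N + 1 - m * d)) * q ^ d := by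
            rw [show β ^ (m * d) = β ^ j * β by rw [hj, pow_succ]]; ring
        _ ≤ _ := by gcongr
    · intro d _ _
      positivity
  rw [← mul_sum] at hsum
  have h3 := hq (N + 1)
  have h4 : (k * c k m a d₀ N : ℝ) * (θ * (1 + ∑ d ∈ Ioc d₀ (N + 1), q ^ d)) ≤
      k * c k m a d₀ N * 1 := by gcongr
  rw [hβ] at hsum ⊢
  nlinarith

lemma exists_good (k : ℕ) [NeZero k] (m : ℕ) (hm : 1 ≤ m) (a : ℝ) (d₀ : ℕ)
    (hc : ∀ N, 0 < c k m a d₀ N) : ∃ x : ℕ → Fin k, ∀ N, Good m a d₀ N x := by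
  have hclosed : ∀ N, IsClosed {x : ℕ → Fin k | Good m a d₀ N x} := by
    intro N
    let f : (ℕ → Fin k) → (Fin N → Fin k) := fun x i => x i
    have hf : Continuous f := by fun_prop
    have : {x : ℕ → Fin k | Good m a d₀ N x} = f ⁻¹' {w | Good m a d₀ N (ext w)} := by
      ext x
      simp only [Set.mem_ofPred_eq, Set.mem_preimage]
      apply good_congr
      intro j hj
      simp [ext, hj, f]
    rw [this]
    exact (isClosed_discrete _).preimage hf
  have := IsCompact.nonempty_iInter_of_sequence_nonempty_isCompact_isClosed
    (fun N => {x : ℕ → Fin k | Good m a d₀ N x})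
    (fun N x hx => good_mono (Nat.le_succ N) hx)
    (fun N => by
      obtain ⟨w, hw⟩ := card_pos.1 (hc N)
      simp only [mem_filter] at hw
      exact ⟨_, hw.2⟩)
    ((hclosed 0).isCompact) hclosed
  obtain ⟨x, hx⟩ := this
  exact ⟨x, fun N => Set.mem_iInter.1 hx N⟩

open Classical in
lemma B_bound (k : ℕ) [NeZero k] (m : ℕ) (hm : 1 ≤ m) (a s : ℝ) (hs : 0 ≤ s) (d : ℕ) :
    (B k m a d : ℝ) * Real.exp (s * (a * d)) ≤
      ((k : ℝ) ^ m + k * (Real.exp s - 1)) ^ d := by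
  let P : (Fin m → Fin k) → Prop := fun v => ∀ i' j', v i' = v j'
  let g : (Fin m → Fin k) → ℝ := fun v => if P v then Real.exp s else 1
  have hg : ∑ v, g v = (k : ℝ) ^ m + k * (Real.exp s - 1) := by
    have h1 : ∀ v, g v = 1 + (if P v then (Real.exp s - 1) else 0) := by
      intro v; simp only [g]; split_ifs <;> ring
    have h2 : (univ.filter P).card = k := by
      have : univ.filter P = univ.image (fun z : Fin k => fun _ : Fin m => z) := by
        ext v
        simp only [P, mem_filter, mem_univ, true_and, mem_image]
        constructor
        · intro h; exact ⟨v ⟨0, hm⟩, funext fun i => h _ _⟩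
        · rintro ⟨z, rfl⟩ i j; rfl
      rw [this, card_image_of_injective, card_univ, Fintype.card_fin]
      intro z z' h
      exact congrFun h ⟨0, hm⟩
    simp only [h1, sum_add_distrib]
    rw [← sum_filter, sum_const, sum_const, h2, nsmul_eq_mul, nsmul_eq_mul]
    simp
  rw [← hg, Fintype.sum_pow]
  let e : (Fin (m * d) → Fin k) ≃ (Fin d → Fin m → Fin k) :=
    { toFun := fun w i j => w (finProdFinEquiv (j, i))
      invFun := fun v t => v (finProdFinEquiv.symm t).2 (finProdFinEquiv.symm t).1
      left_inv := fun w => by funext t; exact congrArg w (finProdFinEquiv.apply_symm_apply t)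
      right_inv := fun v => by funext i j; simp }
  rw [← Equiv.sum_comp e]
  have hcnt : ∀ w : Fin (m * d) → Fin k, ∏ i, g (e w i) = Real.exp (s * cnt m (ext w) 0 d) := by
    intro w
    have h1 : cnt m (ext w) 0 d = (univ.filter (fun i : Fin d => P (e w i))).card := by
      unfold cnt
      have hval : ∀ (i : Fin d) (j : Fin m), ext w (0 + i.1 + j.1 * d) = e w i j := by
        intro i j
        have hlt := pos_lt (n := 0) (N := m * d) (by omega) i.2 j
        simp only [ext, hlt, dif_pos]
        simp only [e, Equiv.coe_fn_mk]
        congr 1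
        apply Fin.ext
        simp [finProdFinEquiv, mul_comm]
      symm
      refine card_bij (fun i _ => i.1) ?_ ?_ ?_
      · intro i hi
        simp only [mem_filter, mem_range, mem_univ, true_and] at hi ⊢
        refine ⟨i.2, fun i' j' => ?_⟩
        rw [hval, hval]
        exact hi i' j'
      · intro i _ j _ h
        exact Fin.ext h
      · intro i hi
        simp only [mem_filter, mem_range] at hi
        refine ⟨⟨i, hi.1⟩, ?_, rfl⟩
        simp only [mem_filter, mem_univ, true_and]
        intro i' j'
        have := hi.2 i' j'
        rwa [hval ⟨i, hi.1⟩ i', hval ⟨i, hi.1⟩ j'] at this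
    rw [h1]
    simp only [g]
    rw [prod_ite]
    simp [← Real.exp_nat_mul, mul_comm]
  simp only [hcnt]
  unfold B
  rw [← nsmul_eq_mul, ← sum_const]
  refine (sum_le_sum ?_).trans (sum_le_sum_of_subset_of_nonneg (filter_subset _ _) ?_)
  · intro w hw
    have := (mem_filter.1 hw).2
    unfold Bad at this
    apply Real.exp_le_exp.2
    gcongr
  · intros; positivity

lemma exists_d0 (θ q : ℝ) (hθ : 0 < θ) (hθ1 : θ < 1) (hq0 : 0 ≤ q) (hq1 : q < 1) :
    ∃ d₀ : ℕ, ∀ N, θ * (1 + ∑ d ∈ Ioc d₀ N, q ^ d) ≤ 1 := by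
  obtain ⟨d₀, hd⟩ := exists_pow_lt_of_lt_one (y := q) (x := (1 - θ) * (1 - q))
    (mul_pos (by linarith) (by linarith)) hq1
  refine ⟨d₀, fun N => ?_⟩
  have h1 : ∑ d ∈ Ioc d₀ N, q ^ d ≤ ∑ d ∈ Ico d₀ (N + 1), q ^ d := by
    apply sum_le_sum_of_subset_of_nonneg
    · intro d; simp only [mem_Ioc, mem_Ico]; omega
    · intros; positivity
  have h2 := geom_sum_Ico_le_of_lt_one (m := d₀) (n := N + 1) hq0 hq1
  have h3 : q ^ d₀ / (1 - q) ≤ 1 - θ := by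
    rw [div_le_iff₀ (by linarith)]; exact hd.le
  nlinarith

end LocCorr

open LocCorr in
/-- For all `k, m ≥ 2` and `ε > 0` there exist an infinite word `x` over an
alphabet of size `k` and `d₀ = d₀(ε)` such that for all `d > d₀`, taking
`r = (0, d, 2d, …, (m-1)d)`, we have `D_r^d ≥ 1 - 1/k^(m-1) - ε`. -/
theorem exists_word_large_local_correlation
    (k m : ℕ) (hk : 2 ≤ k) (hm : 2 ≤ m) (ε : ℝ) (hε : 0 < ε) :
    ∃ (x : ℕ → ℕ) (d₀ : ℕ), (∀ n, x n < k) ∧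
      ∀ d : ℕ, d₀ < d →
        1 - 1 / (k : ℝ) ^ (m - 1) - ε ≤
          ⨅ n : ℕ, (∑ i ∈ Finset.Ico n (n + d),
            (if ∀ i' j' : Fin m, x (i + i'.1 * d) = x (i + j'.1 * d) then (0 : ℝ) else 1)) / d := by
  classical
  have : NeZero k := ⟨by omega⟩
  have hk0 : (1 : ℝ) ≤ k := by exact_mod_cast (by omega : 1 ≤ k)
  have hm0 : (0 : ℝ) < m := by exact_mod_cast (by omega : 0 < m)
  set p : ℝ := 1 / (k : ℝ) ^ (m - 1) with hp
  have hp0 : 0 < p := by positivity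
  have hp1 : p ≤ 1 := by
    rw [hp, div_le_one (by positivity)]; exact one_le_pow₀ hk0
  have hkp : (k : ℝ) = k ^ m * p := by
    obtain ⟨j, rfl⟩ : ∃ j, m = j + 1 := ⟨m - 1, by omega⟩
    rw [hp]; simp; field_simp; ring
  set s : ℝ := min 1 (ε / 2) with hs
  have hs0 : 0 < s := lt_min one_pos (by linarith)
  have hs1 : s ≤ 1 := min_le_left _ _
  have hs2 : s ≤ ε / 2 := min_le_right _ _
  set v : ℝ := ε * s / 2 with hv
  have hv0 : 0 < v := by positivity
  set θ : ℝ := Real.exp (-(v / (2 * m))) with hθ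
  set q : ℝ := Real.exp (-(v / 2)) with hq
  have hθ0 : 0 < θ := Real.exp_pos _
  have hθ1 : θ < 1 := Real.exp_lt_one_iff.2 (by simp; positivity)
  have hq0 : 0 < q := Real.exp_pos _
  have hq1 : q < 1 := Real.exp_lt_one_iff.2 (by simp; positivity)
  have hB : ∀ d, (B k m (p + ε) d : ℝ) ≤ (k * θ) ^ (m * d) * q ^ d := by
    intro d
    have h1 := B_bound k m (by omega) (p + ε) s hs0.le d
    have hes : Real.exp s - 1 ≤ s + s ^ 2 := by
      have := Real.abs_exp_sub_one_sub_id_le (x := s) (by rw [abs_of_pos hs0]; exact hs1)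
      have := (abs_le.1 this).2
      linarith
    have h2 : (k : ℝ) ^ m + k * (Real.exp s - 1) ≤ k ^ m * Real.exp (p * (s + s ^ 2)) := by
      have h3 := Real.add_one_le_exp (p * (s + s ^ 2))
      have h4 : p * (Real.exp s - 1) ≤ p * (s + s ^ 2) := by gcongr
      calc (k : ℝ) ^ m + k * (Real.exp s - 1) = k ^ m * (1 + p * (Real.exp s - 1)) := by
            conv_lhs => rw [show (k : ℝ) * (Real.exp s - 1) = (k ^ m * p) * (Real.exp s - 1) by
              rw [← hkp]]
            ring
        _ ≤ _ := by gcongr; linarith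
    have h0 : 0 ≤ (k : ℝ) ^ m + k * (Real.exp s - 1) := by
      have := Real.add_one_le_exp s
      have : 0 ≤ Real.exp s - 1 := by linarith
      positivity
    have h5 := h1.trans (pow_le_pow_left₀ h0 h2 d)
    rw [← le_div_iff₀ (Real.exp_pos _)] at h5
    refine h5.trans ?_
    rw [div_le_iff₀ (Real.exp_pos _), mul_pow, mul_pow, ← pow_mul, mul_assoc, mul_assoc]
    refine mul_le_mul_of_nonneg_left ?_ (by positivity)
    rw [hθ, hq, ← Real.exp_nat_mul, ← Real.exp_nat_mul, ← Real.exp_nat_mul, ← Real.exp_add,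
      ← Real.exp_add]
    apply Real.exp_le_exp.2
    have h6 : ((m * d : ℕ) : ℝ) * -(v / (2 * m)) = d * (-(v / 2)) := by
      push_cast; field_simp
    rw [h6]
    have h7 : p * (s + s ^ 2) ≤ -(v / 2) + (-(v / 2) + s * (p + ε)) := by
      rw [hv]
      have : p * s ^ 2 ≤ 1 * s ^ 2 := by gcongr
      nlinarith
    have := mul_le_mul_of_nonneg_left h7 (Nat.cast_nonneg (α := ℝ) d)
    linarith
  obtain ⟨d₀, hd₀⟩ := exists_d0 θ q hθ0 hθ1 hq0.le hq1
  have hc : ∀ N, 0 < c k m (p + ε) d₀ N := by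
    intro N
    induction N with
    | zero =>
      unfold c
      refine card_pos.2 ⟨fun _ => 0, ?_⟩
      simp only [mem_filter, mem_univ, true_and]
      intro d n hd hn
      have : 0 < m * d := Nat.mul_pos (by omega) (by omega)
      omega
    | succ N ih =>
      have := growth k m (by omega) (p + ε) d₀ θ q hθ0 hB hd₀ hq0.le N
      have h' : (0 : ℝ) < c k m (p + ε) d₀ N := by exact_mod_cast ih
      have : (0 : ℝ) < c k m (p + ε) d₀ (N + 1) := lt_of_lt_of_le (by positivity) this
      exact_mod_cast this
  obtain ⟨x, hx⟩ := exists_good k m (by omega) (p + ε) d₀ hc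
  refine ⟨fun n => x n, d₀, fun n => (x n).2, fun d hd => le_ciInf fun n => ?_⟩
  have hd0 : (0 : ℝ) < d := by exact_mod_cast (by omega : 0 < d)
  have hb := hx _ d n hd le_rfl
  unfold Bad cnt at hb
  rw [not_lt] at hb
  rw [le_div_iff₀ hd0, sum_Ico_eq_sum_range]
  simp only [add_tsub_cancel_left, Fin.val_inj]
  have h1 : ∀ i, (if ∀ i' j' : Fin m, x (n + i + i'.1 * d) = x (n + i + j'.1 * d)
      then (0 : ℝ) else 1) = 1 - (if ∀ i' j' : Fin m, x (n + i + i'.1 * d) = x (n + i + j'.1 * d)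
      then (1 : ℝ) else 0) := by
    intro i; split_ifs <;> ring
  simp only [h1, sum_sub_distrib, sum_boole, sum_const, card_range, nsmul_eq_mul, mul_one]
  linarith
end

section
/- Let k be a prime, let (â(n))_{n≥0} be a generalized Rudin-Shapiro sequence over {0,1,…,k−1} with admissible function g, and let r_1, r_2 : ℕ → ℕ be functions with r_1(N) < r_2(N) for all N and r_2(N) = o(N) as N → ∞. Then Σ_{n<N} δ(n+r_1(N), n+r_2(N)) ∼ (1 − 1/k) N as N → ∞, i.e., the ratio of the two sides tends to 1. -/
open Finset Filter Real

/-- A function `g : {0,…,k-1} × ℤ → ℤ` (encoded as `g : ℕ → ℤ → ℤ`), periodic in its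
second argument with period `k`, is admissible if for all `0 ≤ u < u + i ≤ k - 1` the set
`{(g(u+i,n) - g(u,n)) mod k : 0 ≤ n ≤ k-1}` equals `{0,1,…,k-1}`. -/
def Admissible (k : ℕ) (g : ℕ → ℤ → ℤ) : Prop :=
  (∀ (j : ℕ) (n : ℤ), g j (n + k) = g j n) ∧
  (∀ u i : ℕ, 0 < i → u + i ≤ k - 1 → ∀ c : ℕ, c < k →
    ∃ n : ℕ, n < k ∧ (g (u + i) (n : ℤ) - g u (n : ℤ)) % (k : ℤ) = (c : ℤ))

/-- `(â(n))` is a generalized Rudin–Shapiro sequence over `{0,…,k-1}` (with companion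
integer sequence `a` and admissible function `g`). -/
def IsGenRudinShapiro (k : ℕ) (g : ℕ → ℤ → ℤ) (a : ℕ → ℤ) (ahat : ℕ → ℕ) : Prop :=
  (∀ n, ahat n < k) ∧
  (∀ n, ((ahat n : ℤ)) % (k : ℤ) = a n % (k : ℤ)) ∧
  (∀ n : ℕ, 1 ≤ n → ∀ j : ℕ, j < k → a (n * k + j) = a n + g j (n : ℤ))

namespace GRS

lemma Nv_iff {k N v q : ℕ} (hv : v < k) : q < (N + k - 1 - v) / k ↔ q * k + v < N := by
  have hk : 0 < k := by omega
  rw [← Nat.succ_le_iff, Nat.le_div_iff_mul_le hk, Nat.succ_mul]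
  omega

lemma sum_split {M : Type*} [AddCommMonoid M] {k : ℕ} (hk : 0 < k) (N : ℕ) (f : ℕ → M) :
    ∑ n ∈ range N, f n
      = ∑ v ∈ range k, ∑ q ∈ range ((N + k - 1 - v) / k), f (q * k + v) := by
  rw [Finset.sum_sigma']
  refine Finset.sum_nbij' (fun n => ⟨n % k, n / k⟩) (fun p => p.2 * k + p.1) ?_ ?_ ?_ ?_ ?_
  · intro n hn
    have h1 := Nat.mod_lt n hk
    simp only [mem_sigma, mem_range] at hn ⊢
    exact ⟨h1, (Nv_iff h1).2 (by rw [Nat.div_add_mod']; exact hn)⟩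
  · rintro ⟨v, q⟩ h
    simp only [mem_sigma, mem_range] at h ⊢
    exact (Nv_iff h.1).1 h.2
  · intro n _
    exact Nat.div_add_mod' n k
  · rintro ⟨v, q⟩ h
    simp only [mem_sigma, mem_range] at h
    have h1 : (q * k + v) % k = v := by
      rw [Nat.mul_add_mod_self_right, Nat.mod_eq_of_lt h.1]
    have h2 : (q * k + v) / k = q := by
      rw [Nat.add_comm, Nat.add_mul_div_right _ _ hk, Nat.div_eq_of_lt h.1, zero_add]
    simp [h1, h2]
  · intro n _
    simp only [Nat.div_add_mod']

lemma sum_Nv {k : ℕ} (hk : 0 < k) (N : ℕ) :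
    ∑ v ∈ range k, (N + k - 1 - v) / k = N := by
  have := sum_split hk N (fun _ => (1 : ℕ))
  simpa using this.symm

lemma sum_sv {k : ℕ} (hk : 0 < k) (r : ℕ) :
    ∑ v ∈ range k, (r + v) / k = r := by
  rw [← Finset.sum_range_reflect, ← sum_Nv hk r]
  refine Finset.sum_congr rfl fun v hv => ?_
  rw [mem_range] at hv
  rw [sum_Nv hk r]
  congr 1
  omega

variable {k : ℕ}

/-- reduction of `g` modulo `k` in both arguments -/
noncomputable def G (k : ℕ) (g : ℕ → ℤ → ℤ) (j : ℕ) (x : ZMod k) : ZMod k :=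
  ((g j (x.val : ℤ) : ℤ) : ZMod k)

lemma per_mul {g : ℕ → ℤ → ℤ} (hg : Admissible k g) (j : ℕ) (n : ℤ) (m : ℕ) :
    g j (n + k * m) = g j n := by
  induction m with
  | zero => simp
  | succ m ih =>
    rw [← ih, ← hg.1 j (n + k * m)]
    congr 1; push_cast; ring

lemma G_nat {g : ℕ → ℤ → ℤ} (hg : Admissible k g) (j n : ℕ) :
    G k g j (n : ZMod k) = ((g j (n : ℤ) : ℤ) : ZMod k) := by
  unfold G
  rw [ZMod.val_natCast]
  conv_rhs => rw [← Nat.mod_add_div n k]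
  push_cast
  rw [← per_mul hg j _ (n / k)]
  push_cast
  rfl

lemma sum_char_zero [NeZero k] {g : ℕ → ℤ → ℤ} (hg : Admissible k g) {ψ : AddChar (ZMod k) ℂ}
    (hψ : ψ ≠ 1) (u i : ℕ) (hi : 0 < i) (hui : u + i < k) :
    ∑ x : ZMod k, ψ (G k g u x - G k g (u + i) x) = 0 := by
  have hsurj : Function.Surjective (fun x : ZMod k => G k g u x - G k g (u + i) x) := by
    intro c
    obtain ⟨n, hn, h⟩ := hg.2 u i hi (by omega) (-c).val (ZMod.val_lt _)
    refine ⟨(n : ZMod k), ?_⟩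
    simp only [G_nat hg]
    have h2 : ((g (u + i) n - g u n : ℤ) : ZMod k) = (((-c).val : ℤ) : ZMod k) := by
      rw [← h, ZMod.intCast_mod]
    rw [Int.cast_natCast, ZMod.natCast_zmod_val] at h2
    push_cast at h2
    linear_combination -h2
  have hbij := Finite.surjective_iff_bijective.1 hsurj
  rw [hbij.sum_comp (fun y => ψ y)]
  exact AddChar.sum_eq_zero_of_ne_one hψ

/-- the weighted correlation sum -/
noncomputable def T (k : ℕ) (a : ℕ → ℤ) (ψ : AddChar (ZMod k) ℂ) (N r : ℕ) (w : ZMod k → ℂ) : ℂ :=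
  ∑ q ∈ range N, w (q : ZMod k) * ψ ((a q : ZMod k) - (a (q + r) : ZMod k))

lemma norm_term [NeZero k] (ψ : AddChar (ZMod k) ℂ) {z : ℂ} (hz : ‖z‖ ≤ 1) (y : ZMod k) :
    ‖z * ψ y‖ ≤ 1 := by
  rw [norm_mul, AddChar.norm_apply, mul_one]; exact hz

lemma norm_T_le [NeZero k] (a : ℕ → ℤ) (ψ : AddChar (ZMod k) ℂ) (N r : ℕ) (w : ZMod k → ℂ)
    (hw : ∀ x, ‖w x‖ ≤ 1) : ‖T k a ψ N r w‖ ≤ N := by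
  unfold T
  refine (norm_sum_le _ _).trans ?_
  refine (Finset.sum_le_sum (g := fun _ => (1 : ℝ)) fun q _ => norm_term ψ (hw _) _).trans ?_
  simp

lemma sum_periodic_le [NeZero k] (w : ZMod k → ℂ) (hw : ∀ x, ‖w x‖ ≤ 1) (h0 : ∑ x, w x = 0)
    (N : ℕ) : ‖∑ q ∈ range N, w (q : ZMod k)‖ ≤ k := by
  have hk : 0 < k := Nat.pos_of_ne_zero (NeZero.ne k)
  have hblock : ∑ q ∈ range k, w (q : ZMod k) = 0 := by
    rw [← h0]
    refine Finset.sum_nbij' (fun q => (q : ZMod k)) (fun x => x.val) ?_ ?_ ?_ ?_ ?_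
    · simp
    · intro x _; simpa using ZMod.val_lt x
    · intro q hq; exact ZMod.val_cast_of_lt (by simpa using hq)
    · simp
    · simp
  induction N using Nat.strong_induction_on with
  | _ N ih =>
    by_cases h : N < k
    · refine (norm_sum_le _ _).trans ?_
      refine (Finset.sum_le_sum (g := fun _ => (1 : ℝ)) fun q _ => hw _).trans ?_
      simpa using h.le
    · obtain ⟨m, rfl⟩ := Nat.exists_eq_add_of_le (not_lt.1 h)
      rw [Finset.sum_range_add, hblock, zero_add]
      simpa using ih m (by omega)

/-- new weights -/
noncomputable def W (k : ℕ) (g : ℕ → ℤ → ℤ) (ψ : AddChar (ZMod k) ℂ) (w : ZMod k → ℂ) (r v : ℕ)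
    (x : ZMod k) : ℂ :=
  w (v : ZMod k) * ψ (G k g v x - G k g ((r + v) % k) (x + ((r + v) / k : ℕ)))

lemma step_v [NeZero k] {g : ℕ → ℤ → ℤ} {a : ℕ → ℤ} {ahat : ℕ → ℕ}
    (hg : Admissible k g) (ha : IsGenRudinShapiro k g a ahat)
    (ψ : AddChar (ZMod k) ℂ) (w : ZMod k → ℂ) (hw : ∀ x, ‖w x‖ ≤ 1) (r v M : ℕ) (hv : v < k) :
    ‖∑ q ∈ range M, w ((q * k + v : ℕ) : ZMod k) *
        ψ ((a (q * k + v) : ZMod k) - (a (q * k + v + r) : ZMod k))‖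
      ≤ ‖T k a ψ M ((r + v) / k) (W k g ψ w r v)‖ + 2 := by
  have hk : 0 < k := Nat.pos_of_ne_zero (NeZero.ne k)
  have hW : ∀ x, ‖W k g ψ w r v x‖ ≤ 1 := fun x => norm_term ψ (hw _) _
  rcases M with _ | M
  · simp [T]
  have key : ∀ q, 1 ≤ q → w ((q * k + v : ℕ) : ZMod k) *
        ψ ((a (q * k + v) : ZMod k) - (a (q * k + v + r) : ZMod k))
      = W k g ψ w r v (q : ZMod k) *
        ψ ((a q : ZMod k) - (a (q + (r + v) / k) : ZMod k)) := by
    intro q hq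
    have e1 : q * k + v + r = (q + (r + v) / k) * k + (r + v) % k := by
      have := Nat.div_add_mod' (r + v) k
      rw [Nat.add_mul]; omega
    rw [e1, ha.2.2 q hq v hv, ha.2.2 (q + (r + v) / k) (Nat.le_add_right_of_le hq) _ (Nat.mod_lt _ hk)]
    unfold W
    rw [← Nat.cast_add, G_nat hg, G_nat hg, mul_assoc, ← AddChar.map_add_eq_mul]
    congr 2
    · simp
    · push_cast; ring
  unfold T
  rw [Finset.sum_range_succ', Finset.sum_range_succ' (n := M)]
  rw [Finset.sum_congr rfl (fun q _ => key (q + 1) (by omega))]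
  set A := ∑ q ∈ range M, W k g ψ w r v ((q + 1 : ℕ) : ZMod k) *
        ψ ((a (q + 1) : ZMod k) - (a (q + 1 + (r + v) / k) : ZMod k))
  set b := w ((0 * k + v : ℕ) : ZMod k) *
        ψ ((a (0 * k + v) : ZMod k) - (a (0 * k + v + r) : ZMod k)) with hb
  set c := W k g ψ w r v ((0 : ℕ) : ZMod k) *
        ψ ((a 0 : ZMod k) - (a (0 + (r + v) / k) : ZMod k)) with hc
  have h1 : ‖b‖ ≤ 1 := norm_term ψ (hw _) _
  have h2 : ‖c‖ ≤ 1 := norm_term ψ (hW _) _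
  calc ‖A + b‖ = ‖(A + c) + (b - c)‖ := by congr 1; ring
    _ ≤ ‖A + c‖ + ‖b - c‖ := norm_add_le _ _
    _ ≤ ‖A + c‖ + 2 := by linarith [norm_sub_le b c]

lemma step [NeZero k] {g : ℕ → ℤ → ℤ} {a : ℕ → ℤ} {ahat : ℕ → ℕ}
    (hg : Admissible k g) (ha : IsGenRudinShapiro k g a ahat)
    (ψ : AddChar (ZMod k) ℂ) (w : ZMod k → ℂ) (hw : ∀ x, ‖w x‖ ≤ 1) (N r : ℕ) :
    ‖T k a ψ N r w‖ ≤ ∑ v ∈ range k,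
      (‖T k a ψ ((N + k - 1 - v) / k) ((r + v) / k) (W k g ψ w r v)‖ + 2) := by
  have hk : 0 < k := Nat.pos_of_ne_zero (NeZero.ne k)
  conv_lhs => unfold T
  rw [sum_split hk]
  refine (norm_sum_le _ _).trans (Finset.sum_le_sum fun v hv => ?_)
  exact step_v hg ha ψ w hw r v _ (mem_range.1 hv)

lemma T_zero [NeZero k] {g : ℕ → ℤ → ℤ} (a : ℕ → ℤ) (hg : Admissible k g)
    {ψ : AddChar (ZMod k) ℂ} (hψ : ψ ≠ 1) (w : ZMod k → ℂ) (hw : ∀ x, ‖w x‖ ≤ 1)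
    (r v M : ℕ) (hr : 1 ≤ r) (hs : (r + v) / k = 0) :
    ‖T k a ψ M ((r + v) / k) (W k g ψ w r v)‖ ≤ k := by
  have hk : 0 < k := Nat.pos_of_ne_zero (NeZero.ne k)
  have hlt : r + v < k := by
    rcases Nat.div_eq_zero_iff.1 hs with h | h <;> omega
  have hW : ∀ x, ‖W k g ψ w r v x‖ ≤ 1 := fun x => norm_term ψ (hw _) _
  have h0 : ∑ x, W k g ψ w r v x = 0 := by
    unfold W
    rw [hs, Nat.mod_eq_of_lt hlt, ← Finset.mul_sum]
    have := sum_char_zero hg hψ v r hr (by omega)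
    rw [add_comm v r] at this
    simp [this]
  have := sum_periodic_le _ hW h0 M
  unfold T
  simpa [hs] using this

lemma main_bound (hk : 2 ≤ k) [NeZero k] {g : ℕ → ℤ → ℤ} {a : ℕ → ℤ} {ahat : ℕ → ℕ}
    (hg : Admissible k g) (ha : IsGenRudinShapiro k g a ahat)
    {ψ : AddChar (ZMod k) ℂ} (hψ : ψ ≠ 1) (ε : ℝ) (hε : 0 < ε) :
    ∃ C : ℝ, 0 ≤ C ∧ ∀ (N r : ℕ) (w : ZMod k → ℂ), (∀ x, ‖w x‖ ≤ 1) → 1 ≤ r →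
      ‖T k a ψ N r w‖ ≤ ε * N + C * r := by
  have hk0 : 0 < k := by omega
  obtain ⟨E, hE⟩ : ∃ E : ℝ, E = k * (k + 2) := ⟨_, rfl⟩
  have hE0 : 0 ≤ E := by rw [hE]; positivity
  obtain ⟨N0, hN0⟩ := exists_nat_ge (2 * E / ε + 2)
  have hN2 : (2 : ℝ) ≤ N0 := le_trans (by have : 0 ≤ 2 * E / ε := by positivity
                                          linarith) hN0
  obtain ⟨C, hC⟩ : ∃ C : ℝ, C = N0 + E := ⟨_, rfl⟩
  have hC0 : 0 ≤ C := by rw [hC]; linarith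
  refine ⟨C, hC0, ?_⟩
  suffices H : ∀ (N r : ℕ) (w : ZMod k → ℂ), (∀ x, ‖w x‖ ≤ 1) → 1 ≤ r →
      ‖T k a ψ N r w‖ ≤ ε * N + C * r - E by
    intro N r w hw hr
    linarith [H N r w hw hr]
  intro N
  induction N using Nat.strong_induction_on with
  | _ N ih =>
  intro r w hw hr
  have hr' : (1 : ℝ) ≤ r := by exact_mod_cast hr
  by_cases hN : N ≤ N0
  · have h1 := norm_T_le a ψ N r w hw
    have h2 : (N : ℝ) ≤ N0 := by exact_mod_cast hN
    have h3 : C ≤ C * r := le_mul_of_one_le_right hC0 hr'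
    have h4 : 0 ≤ ε * N := by positivity
    linarith
  · push Not at hN
    have hNr : (N0 : ℝ) < N := by exact_mod_cast hN
    have hNbig : 2 ≤ N := by
      have : (2 : ℝ) ≤ N := by linarith
      exact_mod_cast this
    have hNE : E ≤ ε * (N / 2) := by
      have : 2 * E / ε ≤ N := by linarith
      rw [div_le_iff₀ hε] at this
      linarith
    have hlt : ∀ v, (N + k - 1 - v) / k < N := by
      intro v
      rw [Nat.div_lt_iff_lt_mul hk0]
      have : N * 2 ≤ N * k := Nat.mul_le_mul_left _ hk
      have : 2 * k ≤ N * k := Nat.mul_le_mul_right _ hNbig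
      have : (N - 1) * (k - 1) ≥ 1 := Nat.mul_pos (by omega) (by omega)
      obtain ⟨N', rfl⟩ := Nat.exists_eq_add_of_le hNbig
      obtain ⟨k', rfl⟩ := Nat.exists_eq_add_of_le hk
      have : (2 + N') * (2 + k') = 4 + 2 * N' + 2 * k' + N' * k' := by ring
      have : 0 ≤ N' * k' := Nat.zero_le _
      omega
    have hW : ∀ v x, ‖W k g ψ w r v x‖ ≤ 1 := fun v x => norm_term ψ (hw _) _
    have hpos : ∀ v, 1 ≤ (r + v) / k →
        ‖T k a ψ ((N + k - 1 - v) / k) ((r + v) / k) (W k g ψ w r v)‖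
          ≤ ε * ((N + k - 1 - v) / k : ℕ) + C * ((r + v) / k : ℕ) - E := fun v hv =>
      ih _ (hlt v) _ _ (hW v) hv
    have hzero : ∀ v, (r + v) / k = 0 →
        ‖T k a ψ ((N + k - 1 - v) / k) ((r + v) / k) (W k g ψ w r v)‖ ≤ k := fun v hv =>
      T_zero a hg hψ w hw r v _ hr hv
    refine (step hg ha ψ w hw N r).trans ?_
    rcases Nat.lt_or_ge r 2 with h1 | h2
    · obtain rfl : r = 1 := by omega
      obtain ⟨l, rfl⟩ : ∃ l, k = l + 1 := ⟨k - 1, by omega⟩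
      rw [Finset.sum_range_succ]
      have hA : ∑ v ∈ range l,
          (‖T (l+1) a ψ ((N + (l+1) - 1 - v) / (l+1)) ((1 + v) / (l+1)) (W (l+1) g ψ w 1 v)‖ + 2)
          ≤ ∑ v ∈ range l, (((l + 1 : ℕ) : ℝ) + 2) := by
        refine Finset.sum_le_sum fun v hv => ?_
        rw [mem_range] at hv
        linarith [hzero v (Nat.div_eq_of_lt (by omega))]
      rw [Finset.sum_const, card_range, nsmul_eq_mul] at hA
      have e1 : (1 + l) / (l + 1) = 1 := by rw [add_comm]; exact Nat.div_self (by omega)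
      have hB := hpos l (by rw [e1])
      have e2 : N + (l + 1) - 1 - l = N := by omega
      rw [e2] at hB ⊢
      have e3 : ((N / (l + 1) : ℕ) : ℝ) ≤ N / 2 := by
        refine Nat.cast_div_le.trans ?_
        have : (2 : ℝ) ≤ ((l + 1 : ℕ) : ℝ) := by exact_mod_cast hk
        gcongr
      have e4 : ε * ((N / (l + 1) : ℕ) : ℝ) ≤ ε * (N / 2) := by gcongr
      rw [e1] at hB ⊢
      push_cast at hA hB hE ⊢
      nlinarith
    · have hv : ∀ v ∈ range k,
          ‖T k a ψ ((N + k - 1 - v) / k) ((r + v) / k) (W k g ψ w r v)‖ + 2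
          ≤ ε * ((N + k - 1 - v) / k : ℕ) + C * ((r + v) / k : ℕ) + (k + 2)
            - (if v = k - 1 then E else 0) - (if v = k - 2 then E else 0) := by
        intro v hvk
        rw [mem_range] at hvk
        have hk1 : (0 : ℝ) ≤ k := by positivity
        rcases Nat.eq_zero_or_pos ((r + v) / k) with h | h
        · have hlt : r + v < k := by
            rcases Nat.div_eq_zero_iff.1 h with h | h <;> omega
          rw [if_neg (by omega), if_neg (by omega)]
          have h5 : 0 ≤ ε * (((N + k - 1 - v) / k : ℕ) : ℝ) := by positivity
          have h6 : 0 ≤ C * (((r + v) / k : ℕ) : ℝ) := by positivity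
          linarith [hzero v h]
        · have := hpos v h
          by_cases c1 : v = k - 1
          · rw [if_pos c1, if_neg (by omega)]; linarith
          · rw [if_neg c1]
            split_ifs <;> linarith
      refine (Finset.sum_le_sum hv).trans ?_
      rw [Finset.sum_sub_distrib, Finset.sum_sub_distrib, Finset.sum_add_distrib,
        Finset.sum_add_distrib, ← Finset.mul_sum, ← Finset.mul_sum, ← Nat.cast_sum,
        ← Nat.cast_sum, sum_Nv hk0, sum_sv hk0, Finset.sum_ite_eq', Finset.sum_ite_eq',
        if_pos (by rw [mem_range]; omega), if_pos (by rw [mem_range]; omega),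
        Finset.sum_const, card_range, nsmul_eq_mul, ← hE]
      linarith

lemma char_tendsto (hk : 2 ≤ k) [NeZero k] {g : ℕ → ℤ → ℤ} {a : ℕ → ℤ} {ahat : ℕ → ℕ}
    (hg : Admissible k g) (ha : IsGenRudinShapiro k g a ahat)
    {ψ : AddChar (ZMod k) ℂ} (hψ : ψ ≠ 1)
    (r₁ r₂ : ℕ → ℕ) (hr : ∀ N, r₁ N < r₂ N)
    (hr₂ : (fun N : ℕ => (r₂ N : ℝ)) =o[atTop] (fun N : ℕ => (N : ℝ))) :
    (fun N : ℕ => ∑ n ∈ range N, ψ ((a (n + r₁ N) : ZMod k) - (a (n + r₂ N) : ZMod k)))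
      =o[atTop] (fun N : ℕ => (N : ℝ)) := by
  rw [Asymptotics.isLittleO_iff]
  intro ε hε
  obtain ⟨C, hC0, hC⟩ := main_bound hk hg ha hψ (ε / 2) (by positivity)
  have hpos : 0 < ε / 2 + C + 1 := by positivity
  have := hr₂.def (c := ε / 2 / (ε / 2 + C + 1)) (by positivity)
  filter_upwards [this] with N hN
  simp only [Real.norm_natCast] at hN ⊢
  have hN' : (ε / 2 + C + 1) * r₂ N ≤ ε / 2 * N := by
    calc _ ≤ (ε / 2 + C + 1) * (ε / 2 / (ε / 2 + C + 1) * N) := by gcongr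
      _ = _ := by field_simp
  obtain ⟨d, hd⟩ := Nat.exists_eq_add_of_le (hr N).le
  have hd1 : 1 ≤ d := by have := hr N; omega
  have e : ∑ n ∈ range N, ψ ((a (n + r₁ N) : ZMod k) - (a (n + r₂ N) : ZMod k))
      = T k a ψ (r₁ N + N) d (fun _ => 1) - T k a ψ (r₁ N) d (fun _ => 1) := by
    unfold T
    rw [Finset.sum_range_add, add_sub_cancel_left]
    refine Finset.sum_congr rfl fun n _ => ?_
    rw [one_mul, hd, add_comm n (r₁ N), ← add_assoc n, add_comm n (r₁ N)]
  rw [e]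
  have b1 := hC (r₁ N + N) d (fun _ => 1) (by simp) hd1
  have b2 := norm_T_le a ψ (r₁ N) d (fun _ => 1) (by simp)
  have b3 := norm_sub_le (T k a ψ (r₁ N + N) d (fun _ => 1)) (T k a ψ (r₁ N) d (fun _ => 1))
  have c1 : (r₁ N : ℝ) ≤ r₂ N := by exact_mod_cast (hr N).le
  have c2 : (d : ℝ) ≤ r₂ N := by exact_mod_cast (by omega : d ≤ r₂ N)
  push_cast at b1
  have c3 : C * d ≤ C * r₂ N := by gcongr
  have c4 : ε / 2 * r₁ N ≤ ε / 2 * r₂ N := by gcongr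
  nlinarith

end GRS

/-- Corollary: For `k` prime, a generalized Rudin–Shapiro sequence over
`{0,…,k-1}`, and `r₁(N) < r₂(N)` with `r₂(N) = o(N)`, we have
`Σ_{n<N} δ(n+r₁(N), n+r₂(N)) ∼ (1 - 1/k) N`. -/
theorem genRudinShapiro_correlation_asymptotic
    (k : ℕ) (hk : k.Prime) (g : ℕ → ℤ → ℤ) (a : ℕ → ℤ) (ahat : ℕ → ℕ)
    (hg : Admissible k g) (ha : IsGenRudinShapiro k g a ahat)
    (r₁ r₂ : ℕ → ℕ) (hr : ∀ N, r₁ N < r₂ N)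
    (hr₂ : (fun N : ℕ => (r₂ N : ℝ)) =o[atTop] (fun N : ℕ => (N : ℝ))) :
    Filter.Tendsto (fun N : ℕ =>
        (∑ n ∈ Finset.range N,
            (if ahat (n + r₁ N) = ahat (n + r₂ N) then (0 : ℝ) else 1))
          / ((1 - 1 / (k : ℝ)) * N))
      Filter.atTop (nhds 1) := by
  classical
  have : NeZero k := ⟨hk.ne_zero⟩
  have hkC : (k : ℂ) ≠ 0 := by exact_mod_cast hk.ne_zero
  have hkR : (1 : ℝ) < k := by exact_mod_cast hk.one_lt
  have hkpos : (0 : ℝ) < 1 - 1 / (k : ℝ) := by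
    have : 1 / (k : ℝ) < 1 := by rw [div_lt_one (by linarith)]; exact hkR
    linarith
  have hiff : ∀ i j, ahat i = ahat j ↔ (a i : ZMod k) - (a j : ZMod k) = 0 := by
    intro i j
    rw [sub_eq_zero, ZMod.intCast_eq_intCast_iff', ← ha.2.1 i, ← ha.2.1 j]
    rw [Int.emod_eq_of_lt (by positivity) (by exact_mod_cast ha.1 i),
      Int.emod_eq_of_lt (by positivity) (by exact_mod_cast ha.1 j)]
    norm_cast
  have hterm : ∀ i j, (((if ahat i = ahat j then (0 : ℝ) else 1) : ℝ) : ℂ)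
      = (1 - 1 / (k : ℂ)) - 1 / (k : ℂ) * ∑ ψ ∈ (univ : Finset (AddChar (ZMod k) ℂ)).erase 1,
          ψ ((a i : ZMod k) - (a j : ZMod k)) := by
    intro i j
    have h := AddChar.sum_apply_eq_ite ((a i : ZMod k) - (a j : ZMod k))
    rw [← Finset.add_sum_erase _ _ (Finset.mem_univ (1 : AddChar (ZMod k) ℂ)),
      AddChar.one_apply, ZMod.card] at h
    rw [← eq_sub_iff_add_eq'] at h
    rw [h]
    by_cases c : ahat i = ahat j
    · rw [if_pos c, if_pos ((hiff i j).1 c)]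
      push_cast; field_simp; ring
    · rw [if_neg c, if_neg (fun hc => c ((hiff i j).2 hc))]
      push_cast; field_simp; ring
  have hlo : (fun N : ℕ => ∑ ψ ∈ (univ : Finset (AddChar (ZMod k) ℂ)).erase 1,
      ∑ n ∈ range N, ψ ((a (n + r₁ N) : ZMod k) - (a (n + r₂ N) : ZMod k)))
      =o[atTop] (fun N : ℕ => (N : ℝ)) :=
    Asymptotics.IsLittleO.fun_sum fun ψ hψ =>
      GRS.char_tendsto hk.two_le hg ha (Finset.ne_of_mem_erase hψ) r₁ r₂ hr hr₂
  set S : ℕ → ℝ := fun N => ∑ n ∈ Finset.range N,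
            (if ahat (n + r₁ N) = ahat (n + r₂ N) then (0 : ℝ) else 1) with hS
  have hlo2 : (fun N : ℕ => S N - (1 - 1 / (k : ℝ)) * N) =o[atTop] (fun N : ℕ => (N : ℝ)) := by
    rw [← Asymptotics.isLittleO_norm_left]
    refine ((hlo.const_mul_left (1 / (k : ℂ))).norm_left).congr_left fun N => ?_
    rw [← Complex.norm_real, ← norm_neg]
    congr 1
    simp only [hS]
    push_cast [-Complex.ofReal_sum]
    rw [Complex.ofReal_sum, Finset.sum_congr rfl (fun n _ => hterm (n + r₁ N) (n + r₂ N)),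
      Finset.sum_sub_distrib, ← Finset.mul_sum, Finset.sum_comm]
    simp only [Finset.sum_const, card_range, nsmul_eq_mul]
    ring
  have hlo3 : (fun N : ℕ => S N - (1 - 1 / (k : ℝ)) * N)
      =o[atTop] (fun N : ℕ => (1 - 1 / (k : ℝ)) * (N : ℝ)) :=
    hlo2.const_mul_right hkpos.ne'
  have := hlo3.tendsto_div_nhds_zero.add_const 1
  rw [zero_add] at this
  refine this.congr' ?_
  filter_upwards [eventually_gt_atTop 0] with N hN
  have hN' : (0 : ℝ) < N := by exact_mod_cast hN
  have : (1 - 1 / (k : ℝ)) * (N : ℝ) ≠ 0 := by positivity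
  rw [sub_div, div_self this]
  ring
end
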